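/- In a matching market with contracts in which students have strict preferences monotone in contract terms, if contracts are substitutes under every college's choice function and every college's choice function satisfies the law of aggregate demand, then the deferred acceptance mechanism (mapping each monotone strict preference profile ≽ to DA(Ch,≽)) is group-strategy-proof. -/

import Mathlib

open scoped Classical

namespace MWC

variable {C S T : Type*} [DecidableEq C] [DecidableEq S] [DecidableEq T] [LinearOrder T]

/-! Contracts are triples `(college, student, term)`.  For `x : C × S × T`,
`x.1` is the college, `x.2.1` the student and `x.2.2` the contract term.
The linear order on `T` plays the role of `▷`: higher terms are better for students. -/

variable (X : Finset (C × S × T))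

/-- The contracts in `X` naming college `c` (the set `X_c`). -/
def Xc (c : C) : Finset (C × S × T) := X.filter fun x => x.1 = c

/-- A set of contracts containing at most one contract per student. -/
def IsAlloc (Y : Finset (C × S × T)) : Prop :=
  ∀ x ∈ Y, ∀ y ∈ Y, x.2.1 = y.2.1 → x = y

/-- `Ch` is a valid choice function for college `c`: from each subset of `X_c` it
chooses a subset with at most one contract per student, and it satisfies the
irrelevance of rejected contracts (IRC). -/
def IsChoice (c : C) (Ch : Finset (C × S × T) → Finset (C × S × T)) : Prop :=
  (∀ Y, Y ⊆ Xc X c → Ch Y ⊆ Y) ∧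
  (∀ Y, Y ⊆ Xc X c → IsAlloc (Ch Y)) ∧
  (∀ Y, Y ⊆ Xc X c → ∀ x ∈ Xc X c, x ∉ Y → x ∉ Ch (insert x Y) → Ch Y = Ch (insert x Y))

/-- The rejection function `R_c(Y) = Y \ Ch_c(Y)`. -/
def Rej (Ch : Finset (C × S × T) → Finset (C × S × T)) (Y : Finset (C × S × T)) :
    Finset (C × S × T) := Y \ Ch Y

/-- Contracts are substitutes under `Ch` (for college `c`). -/
def Substitutes (c : C) (Ch : Finset (C × S × T) → Finset (C × S × T)) : Prop :=
  ∀ Y, Y ⊆ Xc X c → ∀ x ∈ Xc X c, ∀ z ∈ Xc X c, x ∉ Y → z ∉ Y →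
    x ∈ Ch (insert z (insert x Y)) → x ∈ Ch (insert x Y)

/-- The law of aggregate demand for `Ch` (college `c`). -/
def LAD (c : C) (Ch : Finset (C × S × T) → Finset (C × S × T)) : Prop :=
  ∀ Z Y, Z ⊆ Y → Y ⊆ Xc X c → (Ch Z).card ≤ (Ch Y).card

/-- `Y^min`: the contracts of `Y` that give each involved student his
`▷`-worst contract among his contracts in `Y`. -/
def Ymin (Y : Finset (C × S × T)) : Finset (C × S × T) :=
  Y.filter fun y => ∀ y' ∈ Y, y'.2.1 = y.2.1 → ¬ y'.2.2 < y.2.2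

/-- `Ch` is monotone in contract terms: it always chooses from `Y^min`. -/
def MonotoneCh (c : C) (Ch : Finset (C × S × T) → Finset (C × S × T)) : Prop :=
  ∀ Y, Y ⊆ Xc X c → Ch Y ⊆ Ymin Y

/-- `us` represents a strict preference of student `s` over his contracts in `X`
together with the outside option (utility `0`), monotone in contract terms:
a higher contract term is always strictly better. -/
def IsPref (s : S) (us : C × S × T → ℤ) : Prop :=
  (∀ x ∈ X, x.2.1 = s → us x ≠ 0) ∧
  (∀ x ∈ X, ∀ y ∈ X, x.2.1 = s → y.2.1 = s → x ≠ y → us x ≠ us y) ∧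
  (∀ x ∈ X, ∀ y ∈ X, x.2.1 = s → y.2.1 = s → y.2.2 < x.2.2 → us y < us x)

/-- The utility student `s` derives from allocation `Y` (`0` = outside option). -/
def util (us : C × S × T → ℤ) (s : S) (Y : Finset (C × S × T)) : ℤ :=
  ∑ x ∈ Y.filter (fun x => x.2.1 = s), us x

/-- Individual rationality of allocation `Y` in the market `(Ch, u)`. -/
def IndivRat (Ch : C → Finset (C × S × T) → Finset (C × S × T))
    (u : S → C × S × T → ℤ) (Y : Finset (C × S × T)) : Prop :=
  (∀ c, Y.filter (fun x => x.1 = c) = Ch c (Y.filter fun x => x.1 = c)) ∧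
  ∀ y ∈ Y, 0 < u y.2.1 y

/-- College `c` together with allocation `Z` blocks allocation `Y`. -/
def Blocks (Ch : C → Finset (C × S × T) → Finset (C × S × T))
    (u : S → C × S × T → ℤ) (c : C) (Z Y : Finset (C × S × T)) : Prop :=
  Z ⊆ X ∧ IsAlloc Z ∧
  Z.filter (fun x => x.1 = c) ≠ Y.filter (fun x => x.1 = c) ∧
  Z.filter (fun x => x.1 = c) = Ch c ((Y ∪ Z).filter fun x => x.1 = c) ∧
  ∀ z ∈ Z.filter (fun x => x.1 = c), util (u z.2.1) z.2.1 Y ≤ u z.2.1 z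

/-- Stability of allocation `Y` in the market `(Ch, u)`. -/
def Stable (Ch : C → Finset (C × S × T) → Finset (C × S × T))
    (u : S → C × S × T → ℤ) (Y : Finset (C × S × T)) : Prop :=
  Y ⊆ X ∧ IsAlloc Y ∧ IndivRat Ch u Y ∧ ¬ ∃ c Z, Blocks X Ch u c Z Y

/-- The contracts proposed when `D` is the set of contracts rejected so far:
every student proposes his most preferred acceptable not-yet-rejected contract. -/
def proposals (u : S → C × S × T → ℤ) (D : Finset (C × S × T)) : Finset (C × S × T) :=
  (X \ D).filter fun x =>
    0 < u x.2.1 x ∧ ∀ y ∈ X \ D, y.2.1 = x.2.1 → u x.2.1 y ≤ u x.2.1 x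

/-- The contracts tentatively held by the colleges among the proposals `P`:
each college `c` keeps its choice from the contracts proposed to it. -/
def held (Ch : C → Finset (C × S × T) → Finset (C × S × T))
    (P : Finset (C × S × T)) : Finset (C × S × T) :=
  P.filter fun x => x ∈ Ch x.1 (P.filter fun y => y.1 = x.1)

/-- One round of the student-proposing deferred acceptance algorithm, acting on the
cumulative set of rejected contracts. -/
def step (Ch : C → Finset (C × S × T) → Finset (C × S × T))
    (u : S → C × S × T → ℤ) (D : Finset (C × S × T)) : Finset (C × S × T) :=
  D ∪ (proposals X u D \ held Ch (proposals X u D))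

/-- The outcome `DA(Ch, u)` of the student-proposing deferred acceptance algorithm
(the algorithm reaches a fixed point after at most `|X| + 1` rounds). -/
def DA (Ch : C → Finset (C × S × T) → Finset (C × S × T))
    (u : S → C × S × T → ℤ) : Finset (C × S × T) :=
  held Ch (proposals X u ((step X Ch u)^[X.card + 1] ∅))

/-- The cumulative set of contracts proposed up to round `t` of the deferred
acceptance algorithm. -/
def cumProposed (Ch : C → Finset (C × S × T) → Finset (C × S × T))
    (u : S → C × S × T → ℤ) (t : ℕ) : Finset (C × S × T) :=
  (Finset.range (t + 1)).biUnion fun r => proposals X u ((step X Ch u)^[r] ∅)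

/-- Two choice profiles are deferred-acceptance-equivalent if the DA algorithm
produces the same outcome under both, for every profile of strict preferences
monotone in contract terms. -/
def DAeq (Ch Ch' : C → Finset (C × S × T) → Finset (C × S × T)) : Prop :=
  ∀ u : S → C × S × T → ℤ, (∀ s, IsPref X s (u s)) → DA X Ch u = DA X Ch' u

/-- `Ch` is DA-stable: the DA outcome is stable for every profile of strict
preferences monotone in contract terms. -/
def DAStable (Ch : C → Finset (C × S × T) → Finset (C × S × T)) : Prop :=
  ∀ u : S → C × S × T → ℤ, (∀ s, IsPref X s (u s)) → Stable X Ch u (DA X Ch u)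

/-- Mechanism `M` is `Ch`-stable. -/
def StableMech (Ch : C → Finset (C × S × T) → Finset (C × S × T))
    (M : (S → C × S × T → ℤ) → Finset (C × S × T)) : Prop :=
  ∀ u : S → C × S × T → ℤ, (∀ s, IsPref X s (u s)) → Stable X Ch u (M u)

/-- Strategy-proofness of a mechanism on the domain of strict preferences
monotone in contract terms. -/
def SP (M : (S → C × S × T → ℤ) → Finset (C × S × T)) : Prop :=
  ∀ u u' : S → C × S × T → ℤ, (∀ s, IsPref X s (u s)) → (∀ s, IsPref X s (u' s)) →
    ∀ s : S, (∀ s', s' ≠ s → u' s' = u s') →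
      util (u s) s (M u') ≤ util (u s) s (M u)

/-- Group-strategy-proofness of a mechanism on the domain of strict preferences
monotone in contract terms. -/
def GSP (M : (S → C × S × T → ℤ) → Finset (C × S × T)) : Prop :=
  ∀ u u' : S → C × S × T → ℤ, (∀ s, IsPref X s (u s)) → (∀ s, IsPref X s (u' s)) →
    ∀ S' : Set S, S'.Nonempty → (∀ s, s ∉ S' → u' s = u s) →
      ∃ s' ∈ S', util (u s') s' (M u') ≤ util (u s') s' (M u)

/-- The sequence `L` consists of contracts in `X_c`. -/
def SeqIn (c : C) (L : List (C × S × T)) : Prop := ∀ x ∈ L, x ∈ Xc X c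

/-- The sequence `L` is generated from monotone preferences: every contract (of the
relevant college) with the same student and a strictly higher term than the `t`-th
element appears among the first `t` elements. -/
def GenMono (c : C) (L : List (C × S × T)) : Prop :=
  ∀ (t : ℕ) (ht : t < L.length), ∀ x ∈ Xc X c, x.2.1 = (L.get ⟨t, ht⟩).2.1 →
    (L.get ⟨t, ht⟩).2.2 < x.2.2 → x ∈ L.take t

/-- The sequence `L` is observable under `Ch`: the student of each next contract is
not among the students currently chosen by `Ch`. -/
def ObsSeq (Ch : Finset (C × S × T) → Finset (C × S × T)) (L : List (C × S × T)) : Prop :=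
  ∀ (t : ℕ) (ht : t < L.length), 0 < t →
    (L.get ⟨t, ht⟩).2.1 ∉ (Ch (L.take t).toFinset).image fun y => y.2.1

/-- Observable substitutability for monotone preferences. -/
def ObsSub (c : C) (Ch : Finset (C × S × T) → Finset (C × S × T)) : Prop :=
  ∀ L : List (C × S × T), SeqIn X c L → GenMono X c L → ObsSeq Ch L →
    ∀ t : ℕ, t + 1 ≤ L.length →
      Rej Ch (L.take t).toFinset ⊆ Rej Ch (L.take (t + 1)).toFinset

/-- The observable law of aggregate demand for monotone preferences. -/
def ObsLAD (c : C) (Ch : Finset (C × S × T) → Finset (C × S × T)) : Prop :=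
  ∀ L : List (C × S × T), SeqIn X c L → GenMono X c L → ObsSeq Ch L →
    ∀ t : ℕ, t + 1 ≤ L.length →
      (Ch (L.take t).toFinset).card ≤ (Ch (L.take (t + 1)).toFinset).card

/-- `Y` is an observable set under `Ch`. -/
def ObsSet (c : C) (Ch : Finset (C × S × T) → Finset (C × S × T))
    (Y : Finset (C × S × T)) : Prop :=
  ∃ L : List (C × S × T), L.Nodup ∧ L.toFinset = Y ∧ SeqIn X c L ∧
    GenMono X c L ∧ ObsSeq Ch L

/-- `Ytil` is a maximal observable subset of `Y` under `Ch`. -/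
def MaxObsSubset (c : C) (Ch : Finset (C × S × T) → Finset (C × S × T))
    (Y Ytil : Finset (C × S × T)) : Prop :=
  Ytil ⊆ Y ∧ ObsSet X c Ch Ytil ∧
    ∀ Y', ObsSet X c Ch Y' → Ytil ⊆ Y' → Y' ⊆ Y → Y' = Ytil

/-- `U(Y)`: the contracts in `X_c` that are at least as good for the involved
student as some contract of his in `Y`. -/
def Uset (c : C) (Y : Finset (C × S × T)) : Finset (C × S × T) :=
  (Xc X c).filter fun x => ∃ y ∈ Y, x.2.1 = y.2.1 ∧ (y.2.2 < x.2.2 ∨ x = y)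

/-- `Y^∨`: the (under observable substitutability unique) maximal observable subset
of `U(Y)` under `Ch`. -/
noncomputable def vee (c : C) (Ch : Finset (C × S × T) → Finset (C × S × T))
    (Y : Finset (C × S × T)) : Finset (C × S × T) :=
  if h : ∃ V, MaxObsSubset X c Ch (Uset X c Y) V then h.choose else ∅

/-- The virtual choice function
`Ch'_c(Y) = { x ∈ Y^min : x_S ∈ [Ch_c(Y^∨)]_S }`. -/
noncomputable def virtualChoice (c : C) (Ch : Finset (C × S × T) → Finset (C × S × T))
    (Y : Finset (C × S × T)) : Finset (C × S × T) :=
  (Ymin Y).filter fun x => x.2.1 ∈ (Ch (vee X c Ch Y)).image fun y => y.2.1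

section Helpers

/-- Set version of substitutability. -/
theorem sub_set {c : C} {F : Finset (C × S × T) → Finset (C × S × T)}
    (h : Substitutes X c F) {Y Z : Finset (C × S × T)} (hYZ : Y ⊆ Z) (hZ : Z ⊆ Xc X c)
    {x : C × S × T} (hx : x ∈ Y) (hxZ : x ∈ F Z) : x ∈ F Y := by
  classical
  have key : ∀ W : Finset (C × S × T), Y ∪ W ⊆ Xc X c → x ∈ F (Y ∪ W) → x ∈ F Y := by
    intro W
    induction W using Finset.induction_on with
    | empty => intro _ h2; simpa using h2
    | insert z W hz ih =>
      intro h1 h2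
      have hsub' : Y ∪ W ⊆ Xc X c := fun a ha => h1 (by
        simp only [Finset.mem_union, Finset.mem_insert] at ha ⊢; tauto)
      apply ih hsub'
      by_cases hzY : z ∈ Y ∪ W
      · have e : Y ∪ insert z W = Y ∪ W := by
          rw [Finset.union_insert, Finset.insert_eq_self.2 hzY]
        rwa [e] at h2
      · have hzx : z ∉ (Y ∪ W).erase x := fun hh => hzY (Finset.mem_of_mem_erase hh)
        have hxx : x ∈ Y ∪ W := Finset.mem_union_left _ hx
        have e : insert x ((Y ∪ W).erase x) = Y ∪ W := Finset.insert_erase hxx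
        have := h ((Y ∪ W).erase x) (fun a ha => hsub' (Finset.mem_of_mem_erase ha)) x
          (hsub' hxx) z (h1 (by simp)) (by simp) hzx
        have e' : insert x ((Y ∪ W).erase x) = Y ∪ W := by
          ext a; simp only [Finset.mem_insert, Finset.mem_erase]
          constructor
          · rintro (rfl | h); exacts [hxx, h.2]
          · intro h; by_cases a = x <;> tauto
        rw [e'] at this
        apply this
        convert h2 using 2
        ext a; simp only [Finset.mem_insert, Finset.mem_union]; tauto
  apply key Z <;> rw [Finset.union_eq_right.2 hYZ] <;> assumption

/-- Set version of IRC. -/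
theorem irc_set {c : C} {F : Finset (C × S × T) → Finset (C × S × T)}
    (h : IsChoice X c F) {Y Z : Finset (C × S × T)} (hYZ : Y ⊆ Z) (hZ : Z ⊆ Xc X c)
    (hF : F Z ⊆ Y) : F Y = F Z := by
  classical
  have key : ∀ W : Finset (C × S × T), Y ∪ W ⊆ Xc X c → F (Y ∪ W) ⊆ Y → F Y = F (Y ∪ W) := by
    intro W
    induction W using Finset.induction_on with
    | empty => intro _ _; simp
    | insert z W hz ih =>
      intro h1 h2
      have hsub' : Y ∪ W ⊆ Xc X c := fun a ha => h1 (by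
        simp only [Finset.mem_union, Finset.mem_insert] at ha ⊢; tauto)
      have e : F (Y ∪ W) = F (Y ∪ insert z W) := by
        by_cases hzY : z ∈ Y ∪ W
        · rw [Finset.union_insert, Finset.insert_eq_self.2 hzY]
        · have e' : insert z (Y ∪ W) = Y ∪ insert z W := by
            ext a; simp only [Finset.mem_insert, Finset.mem_union]; tauto
          have := h.2.2 (Y ∪ W) hsub' z (h1 (by simp)) hzY
          have e2 := this (by
            intro hh
            apply hzY
            apply Finset.mem_union_left
            apply h2
            convert hh using 2
            ext a; simp only [Finset.mem_insert, Finset.mem_union]; tauto)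
          rw [e2]; congr 1
      rw [← e] at h2 ⊢
      exact ih hsub' h2
  have := key Z
  rw [Finset.union_eq_right.2 hYZ] at this
  exact this hZ hF

variable {X} {Ch : C → Finset (C × S × T) → Finset (C × S × T)}

theorem mem_held {P : Finset (C × S × T)} {x : C × S × T} :
    x ∈ held Ch P ↔ x ∈ P ∧ x ∈ Ch x.1 (P.filter fun y => y.1 = x.1) := by
  simp [held]

theorem filter_sub_Xc {P : Finset (C × S × T)} (hP : P ⊆ X) (c : C) :
    (P.filter fun y => y.1 = c) ⊆ Xc X c := by
  intro a ha
  simp only [Xc, Finset.mem_filter] at ha ⊢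
  exact ⟨hP ha.1, ha.2⟩

theorem held_filter (hCh : ∀ c, IsChoice X c (Ch c)) {P : Finset (C × S × T)} (hP : P ⊆ X)
    (c : C) : ((held Ch P).filter fun y => y.1 = c) = Ch c (P.filter fun y => y.1 = c) := by
  ext a
  rw [Finset.mem_filter, mem_held]
  constructor
  · rintro ⟨⟨_, h⟩, rfl⟩; exact h
  · intro h
    have h' := (hCh c).1 _ (filter_sub_Xc hP c) h
    rw [Finset.mem_filter] at h'
    obtain ⟨h1, rfl⟩ := h'
    exact ⟨⟨h1, h⟩, rfl⟩

theorem held_sub {P : Finset (C × S × T)} : held Ch P ⊆ P := fun _ h => (mem_held.1 h).1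

theorem held_subst (hsub : ∀ c, Substitutes X c (Ch c)) {Y Z : Finset (C × S × T)}
    (hYZ : Y ⊆ Z) (hZ : Z ⊆ X) {x : C × S × T} (hx : x ∈ Y) (hxZ : x ∈ held Ch Z) :
    x ∈ held Ch Y := by
  rw [mem_held] at hxZ ⊢
  exact ⟨hx, sub_set X (hsub x.1) (Finset.filter_subset_filter _ hYZ) (filter_sub_Xc hZ _)
    (Finset.mem_filter.2 ⟨hx, rfl⟩) hxZ.2⟩

theorem held_irc (hCh : ∀ c, IsChoice X c (Ch c)) {Y Z : Finset (C × S × T)}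
    (hYZ : Y ⊆ Z) (hZ : Z ⊆ X) (hF : held Ch Z ⊆ Y) : held Ch Y = held Ch Z := by
  have key : ∀ c, Ch c (Y.filter fun y => y.1 = c) = Ch c (Z.filter fun y => y.1 = c) := by
    intro c
    apply irc_set X (hCh c) (Finset.filter_subset_filter _ hYZ) (filter_sub_Xc hZ _)
    rw [← held_filter hCh hZ]
    exact Finset.filter_subset_filter _ hF
  ext a
  constructor
  · intro h
    rw [mem_held] at h ⊢
    exact ⟨hYZ h.1, key a.1 ▸ h.2⟩
  · intro h
    have h' := hF h
    rw [mem_held] at h ⊢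
    exact ⟨h', (key a.1).symm ▸ h.2⟩

theorem held_lad [Fintype C] (hCh : ∀ c, IsChoice X c (Ch c)) (hlad : ∀ c, LAD X c (Ch c))
    {Y Z : Finset (C × S × T)} (hYZ : Y ⊆ Z) (hZ : Z ⊆ X) :
    (held Ch Y).card ≤ (held Ch Z).card := by
  have key : ∀ P, P ⊆ X → (held Ch P).card =
      ∑ c : C, (Ch c (P.filter fun y => y.1 = c)).card := by
    intro P hP
    rw [Finset.card_eq_sum_card_fiberwise (f := fun y => y.1) (t := Finset.univ)
      (fun _ _ => by simp)]
    refine Finset.sum_congr rfl fun c _ => ?_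
    rw [← held_filter hCh hP c]
  rw [key _ (hYZ.trans hZ), key _ hZ]
  exact Finset.sum_le_sum fun c _ =>
    hlad c _ _ (Finset.filter_subset_filter _ hYZ) (filter_sub_Xc hZ c)

variable {u : S → C × S × T → ℤ}

theorem mem_proposals {D : Finset (C × S × T)} {x : C × S × T} :
    x ∈ proposals X u D ↔ (x ∈ X ∧ x ∉ D) ∧ 0 < u x.2.1 x ∧
      ∀ y, y ∈ X → y ∉ D → y.2.1 = x.2.1 → u x.2.1 y ≤ u x.2.1 x := by
  simp [proposals, and_imp]

theorem proposals_alloc (hu : ∀ s, IsPref X s (u s)) (D : Finset (C × S × T)) :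
    IsAlloc (proposals X u D) := by
  intro x hx y hy hxy
  rw [mem_proposals] at hx hy
  by_contra hne
  have h1 := hx.2.2 y hy.1.1 hy.1.2 hxy.symm
  have h2 := hy.2.2 x hx.1.1 hx.1.2 hxy
  rw [← hxy] at h2
  exact (hu x.2.1).2.1 x hx.1.1 y hy.1.1 rfl hxy.symm hne (le_antisymm h2 h1)

/-- an available acceptable contract yields a proposal at least as good -/
theorem exists_proposal {D : Finset (C × S × T)} {x : C × S × T} (hx : x ∈ X) (hD : x ∉ D)
    (hpos : 0 < u x.2.1 x) :
    ∃ p ∈ proposals X u D, p.2.1 = x.2.1 ∧ u x.2.1 x ≤ u x.2.1 p := by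
  classical
  obtain ⟨p, hp, hmax⟩ := Finset.exists_max_image
    (X.filter fun y => y ∉ D ∧ y.2.1 = x.2.1) (u x.2.1) ⟨x, by simp [hx, hD]⟩
  simp only [Finset.mem_filter] at hp hmax
  obtain ⟨hpX, hpD, hps⟩ := hp
  have hle := hmax x ⟨hx, hD, rfl⟩
  refine ⟨p, ?_, hps, hle⟩
  rw [mem_proposals, hps]
  exact ⟨⟨hpX, hpD⟩, by omega, fun y h1 h2 h3 => hmax y ⟨h1, h2, h3⟩⟩

/-- Rejected contracts by round `t`. -/
def Drej (X : Finset (C × S × T)) (Ch : C → Finset (C × S × T) → Finset (C × S × T))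
    (u : S → C × S × T → ℤ) (t : ℕ) : Finset (C × S × T) := (step X Ch u)^[t] ∅

theorem Drej_succ (t : ℕ) : Drej X Ch u (t + 1) = step X Ch u (Drej X Ch u t) := by
  simp only [Drej, Function.iterate_succ_apply']

theorem mem_step {D : Finset (C × S × T)} {x : C × S × T} : x ∈ step X Ch u D ↔
    x ∈ D ∨ (x ∈ proposals X u D ∧ x ∉ held Ch (proposals X u D)) := by
  simp [step]

theorem Drej_mono {t n : ℕ} (h : t ≤ n) : Drej X Ch u t ⊆ Drej X Ch u n := by
  induction n, h using Nat.le_induction with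
  | base => exact subset_rfl
  | succ n _ ih =>
    rw [Drej_succ]
    exact fun a ha => mem_step.2 (Or.inl (ih ha))

theorem proposals_sub (D : Finset (C × S × T)) : proposals X u D ⊆ X :=
  fun _ h => (mem_proposals.1 h).1.1

theorem Drej_inv (t : ℕ) : ∀ x ∈ Drej X Ch u t, x ∈ X ∧ 0 < u x.2.1 x ∧
    ∀ y, y ∈ X → y ∉ Drej X Ch u t → y.2.1 = x.2.1 → u x.2.1 y ≤ u x.2.1 x := by
  induction t with
  | zero => intro x hx; simp [Drej] at hx
  | succ t ih =>
    intro x hx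
    have hm : Drej X Ch u t ⊆ Drej X Ch u (t + 1) := Drej_mono (Nat.le_succ t)
    rw [Drej_succ, mem_step] at hx
    rcases hx with hx | ⟨hx, _⟩
    · obtain ⟨h1, h2, h3⟩ := ih x hx
      exact ⟨h1, h2, fun y hy hyD => h3 y hy (fun h => hyD (hm h))⟩
    · rw [mem_proposals] at hx
      exact ⟨hx.1.1, hx.2.1, fun y hy hyD => hx.2.2 y hy (fun h => hyD (hm h))⟩

/-- Contracts proposed by round `t`. -/
def Aprop (X : Finset (C × S × T)) (Ch : C → Finset (C × S × T) → Finset (C × S × T))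
    (u : S → C × S × T → ℤ) (t : ℕ) : Finset (C × S × T) :=
  Drej X Ch u t ∪ proposals X u (Drej X Ch u t)

theorem mem_Aprop {t : ℕ} {x : C × S × T} : x ∈ Aprop X Ch u t ↔
    x ∈ Drej X Ch u t ∨ x ∈ proposals X u (Drej X Ch u t) := by simp [Aprop]

theorem Aprop_inv (t : ℕ) : ∀ x ∈ Aprop X Ch u t, x ∈ X ∧ 0 < u x.2.1 x ∧
    ∀ y, y ∈ X → y ∉ Drej X Ch u t → y.2.1 = x.2.1 → u x.2.1 y ≤ u x.2.1 x := by
  intro x hx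
  rcases mem_Aprop.1 hx with hx | hx
  · exact Drej_inv t x hx
  · rw [mem_proposals] at hx
    exact ⟨hx.1.1, hx.2⟩

theorem Aprop_sub (t : ℕ) : Aprop X Ch u t ⊆ X := fun x hx => (Aprop_inv t x hx).1

theorem held_Aprop (hCh : ∀ c, IsChoice X c (Ch c)) (hsub : ∀ c, Substitutes X c (Ch c))
    (t : ℕ) : held Ch (proposals X u (Drej X Ch u t)) = held Ch (Aprop X Ch u t) := by
  have irc : ∀ t, (∀ x ∈ Drej X Ch u t, x ∉ held Ch (Aprop X Ch u t)) →
      held Ch (proposals X u (Drej X Ch u t)) = held Ch (Aprop X Ch u t) := by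
    intro t h
    apply held_irc hCh (fun x hx => mem_Aprop.2 (Or.inr hx)) (Aprop_sub t)
    intro x hx
    rcases mem_Aprop.1 (held_sub hx) with h' | h'
    · exact absurd hx (h x h')
    · exact h'
  have key : ∀ t, (∀ x ∈ Drej X Ch u t, x ∉ held Ch (Aprop X Ch u t)) := by
    intro t
    induction t with
    | zero => intro x hx; simp [Drej] at hx
    | succ t ih =>
      intro x hx hxh
      have hm : Aprop X Ch u t ⊆ Aprop X Ch u (t + 1) := by
        intro a ha
        by_cases haD : a ∈ Drej X Ch u (t + 1)
        · exact mem_Aprop.2 (Or.inl haD)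
        · refine mem_Aprop.2 (Or.inr ?_)
          obtain ⟨h1, h2, h3⟩ := Aprop_inv t a ha
          rw [mem_proposals]
          exact ⟨⟨h1, haD⟩, h2, fun y hy hyD =>
            h3 y hy (fun h => hyD (Drej_mono (Nat.le_succ t) h))⟩
      rw [Drej_succ, mem_step] at hx
      rcases hx with hx | ⟨hx, hx'⟩
      · exact ih x hx (held_subst hsub hm (Aprop_sub _) (mem_Aprop.2 (Or.inl hx)) hxh)
      · rw [irc t ih] at hx'
        exact hx' (held_subst hsub hm (Aprop_sub _) (mem_Aprop.2 (Or.inr hx)) hxh)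
  exact irc t (key t)

theorem Drej_fix : Drej X Ch u (X.card + 1 + 1) = Drej X Ch u (X.card + 1) := by
  have key : ∀ k, k ≤ (Drej X Ch u k).card ∨ Drej X Ch u (k + 1) = Drej X Ch u k := by
    intro k
    induction k with
    | zero => left; simp
    | succ k ih =>
      by_cases he : Drej X Ch u (k + 1) = Drej X Ch u k
      · right
        rw [Drej_succ, he, ← Drej_succ, he]
      · left
        have h1 := ih.resolve_right he
        have h2 : Drej X Ch u k ⊂ Drej X Ch u (k + 1) :=
          lt_of_le_of_ne (Drej_mono (Nat.le_succ k)) (Ne.symm he)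
        have := Finset.card_lt_card h2
        omega
  refine (key (X.card + 1)).resolve_left ?_
  have : (Drej X Ch u (X.card + 1)).card ≤ X.card :=
    Finset.card_le_card fun x hx => (Drej_inv _ x hx).1
  omega

theorem DA_eq_proposals : DA X Ch u = proposals X u (Drej X Ch u (X.card + 1)) := by
  refine Finset.Subset.antisymm held_sub ?_
  intro x hx
  by_contra hn
  have : x ∈ Drej X Ch u (X.card + 1 + 1) := by
    rw [Drej_succ, mem_step]; exact Or.inr ⟨hx, hn⟩
  rw [Drej_fix] at this
  exact (mem_proposals.1 hx).1.2 this

theorem util_of_mem {v : C × S × T → ℤ} {Y : Finset (C × S × T)} (hY : IsAlloc Y)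
    {x : C × S × T} (hx : x ∈ Y) : util v x.2.1 Y = v x := by
  have : Y.filter (fun y => y.2.1 = x.2.1) = {x} := by
    ext a
    simp only [Finset.mem_filter, Finset.mem_singleton]
    constructor
    · rintro ⟨h1, h2⟩; exact hY a h1 x hx h2
    · rintro rfl; exact ⟨hx, rfl⟩
  rw [util, this, Finset.sum_singleton]

theorem util_of_not {v : C × S × T → ℤ} {Y : Finset (C × S × T)} {s : S}
    (h : ∀ x ∈ Y, x.2.1 ≠ s) : util v s Y = 0 := by
  have : Y.filter (fun y => y.2.1 = s) = ∅ := by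
    ext a
    simp only [Finset.mem_filter, Finset.notMem_empty, iff_false, not_and]
    exact h a
  rw [util, this, Finset.sum_empty]

theorem DA_alloc (hu : ∀ s, IsPref X s (u s)) : IsAlloc (DA X Ch u) := by
  rw [DA_eq_proposals]; exact proposals_alloc hu _

theorem DA_util_nonneg (hu : ∀ s, IsPref X s (u s)) (s : S) : 0 ≤ util (u s) s (DA X Ch u) := by
  by_cases h : ∃ x ∈ DA X Ch u, x.2.1 = s
  · obtain ⟨x, hx, rfl⟩ := h
    rw [util_of_mem (DA_alloc hu) hx]
    rw [DA_eq_proposals, mem_proposals] at hx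
    exact hx.2.1.le
  · push Not at h
    rw [util_of_not h]

/-- Not rejected and acceptable contracts are no better than the outcome. -/
theorem DA_util_ge (hu : ∀ s, IsPref X s (u s)) {x : C × S × T} (hx : x ∈ X)
    (hD : x ∉ Drej X Ch u (X.card + 1)) (hpos : 0 < u x.2.1 x) :
    ∃ p ∈ DA X Ch u, p.2.1 = x.2.1 ∧ u x.2.1 x ≤ u x.2.1 p ∧
      util (u x.2.1) x.2.1 (DA X Ch u) = u x.2.1 p := by
  obtain ⟨p, hp, hps, hle⟩ := exists_proposal hx hD hpos
  rw [← DA_eq_proposals] at hp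
  refine ⟨p, hp, hps, hle, ?_⟩
  have := util_of_mem (v := u x.2.1) (DA_alloc hu) hp
  rwa [hps] at this

/-- Contracts proposed by round `t` are at least as good as the outcome. -/
theorem DA_util_le (hu : ∀ s, IsPref X s (u s)) {t : ℕ} (ht : t ≤ X.card + 1) {x : C × S × T}
    (hx : x ∈ Aprop X Ch u t) : util (u x.2.1) x.2.1 (DA X Ch u) ≤ u x.2.1 x := by
  obtain ⟨h1, h2, h3⟩ := Aprop_inv t x hx
  by_cases h : ∃ p ∈ DA X Ch u, p.2.1 = x.2.1
  · obtain ⟨p, hp, hps⟩ := h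
    have := util_of_mem (v := u x.2.1) (DA_alloc hu) hp
    rw [hps] at this
    rw [this]
    rw [DA_eq_proposals, mem_proposals] at hp
    exact h3 p hp.1.1 (fun hh => hp.1.2 (Drej_mono ht hh)) hps
  · push Not at h
    rw [util_of_not h]
    exact h2.le

theorem main_aux [Fintype C] [Fintype S]
    (hCh : ∀ c, IsChoice X c (Ch c))
    (hsub : ∀ c, Substitutes X c (Ch c))
    (hlad : ∀ c, LAD X c (Ch c)) : GSP X (DA X Ch) := by
  classical
  intro u u' hu hu' S' hne hsame
  by_contra hcon
  push Not at hcon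
  set μ := DA X Ch u with hμ
  set μ' := DA X Ch u' with hμ'
  set W : Finset S := Finset.univ.filter fun s => util (u s) s μ < util (u s) s μ' with hW
  have memW : ∀ s, s ∈ W ↔ util (u s) s μ < util (u s) s μ' := by intro s; simp [hW]
  have hS'W : ∀ s ∈ S', s ∈ W := fun s hs => (memW s).2 (hcon s hs)
  have hμ'X : μ' ⊆ X := by rw [hμ', DA_eq_proposals]; exact proposals_sub _
  have hall' : IsAlloc μ' := DA_alloc hu'
  have hmatch : ∀ s ∈ W, ∃ x ∈ μ', x.2.1 = s := by
    intro s hs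
    by_contra h
    push Not at h
    have h1 := (memW s).1 hs
    rw [util_of_not h] at h1
    have := DA_util_nonneg (Ch := Ch) hu s
    rw [← hμ] at this
    omega
  have hrej : ∀ x ∈ μ', x.2.1 ∈ W → x ∈ Drej X Ch u (X.card + 1) := by
    intro x hx hxW
    by_contra hD
    have h1 := (memW _).1 hxW
    rw [util_of_mem hall' hx] at h1
    have h0 := DA_util_nonneg (Ch := Ch) hu x.2.1
    rw [← hμ] at h0
    obtain ⟨p, -, -, h2, h3⟩ := DA_util_ge (Ch := Ch) hu (hμ'X hx) hD (by omega)
    rw [← hμ] at h3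
    omega
  have hex : ∃ t, ∀ x ∈ μ', x.2.1 ∈ W → x ∈ Drej X Ch u t := ⟨_, hrej⟩
  have hmin := fun m => Nat.find_min hex (m := m)
  have hle : Nat.find hex ≤ X.card + 1 := Nat.find_min' hex hrej
  have hspec := Nat.find_spec hex
  obtain ⟨s₁, hs₁⟩ := hne
  obtain ⟨x₁, hx₁, hx₁s⟩ := hmatch s₁ (hS'W s₁ hs₁)
  generalize Nat.find hex = n at hmin hle hspec
  cases n with
  | zero =>
    have := hspec x₁ hx₁ (hx₁s ▸ hS'W s₁ hs₁)
    simp [Drej] at this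
  | succ t =>
    have ht := hmin t (Nat.lt_succ_self t)
    push Not at ht
    obtain ⟨x₀, hx₀, hx₀W, hx₀D⟩ := ht
    have hWA : ∀ x ∈ μ', x.2.1 ∈ W → x ∈ Aprop X Ch u t := by
      intro x hx hxW
      have := hspec x hx hxW
      rw [Drej_succ, mem_step] at this
      exact mem_Aprop.2 (this.imp id And.left)
    have hx₀P : x₀ ∈ proposals X u (Drej X Ch u t) ∧
        x₀ ∉ held Ch (proposals X u (Drej X Ch u t)) := by
      have := hspec x₀ hx₀ hx₀W
      rw [Drej_succ, mem_step] at this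
      exact this.resolve_left hx₀D
    have hPall := proposals_alloc hu (Drej X Ch u t)
    have hheld := held_Aprop (u := u) hCh hsub t
    have hheld' := held_Aprop (u := u') hCh hsub (X.card + 1)
    have hμ'A : μ' = held Ch (Aprop X Ch u' (X.card + 1)) := hheld'
    set B := μ' ∪ (Aprop X Ch u t).filter (fun x => x.2.1 ∉ W) with hB
    set Z := Aprop X Ch u t ∪ μ' with hZ
    have hBA' : B ⊆ Aprop X Ch u' (X.card + 1) := by
      intro x hx
      rw [hB, Finset.mem_union, Finset.mem_filter] at hx
      rcases hx with hx | ⟨hx, hxW⟩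
      · rw [hμ'A] at hx; exact held_sub hx
      · obtain ⟨h1, h2, -⟩ := Aprop_inv t x hx
        have hge := DA_util_le hu (by omega) hx
        have hnW := fun h => hxW ((memW x.2.1).2 h)
        have huu : u' x.2.1 = u x.2.1 := hsame _ (fun h => hxW (hS'W _ h))
        rw [mem_Aprop]
        by_contra hn
        push Not at hn
        obtain ⟨p, hp, hps, h3, h4⟩ := DA_util_ge (Ch := Ch) hu' h1 hn.1 (by rw [huu]; exact h2)
        rw [huu] at h3 h4
        have hpx : p ≠ x := by
          rintro rfl
          apply hn.2
          rwa [DA_eq_proposals] at hp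
        have hneq := (hu x.2.1).2.1 p (hμ'X hp) x h1 hps rfl hpx
        apply hnW
        rw [hμ, hμ']
        omega
    have hHB : held Ch B = μ' := by
      rw [held_irc hCh hBA' (Aprop_sub _), ← hμ'A]
      rw [← hμ'A, hB]
      exact Finset.subset_union_left
    have hZX : Z ⊆ X := Finset.union_subset (Aprop_sub t) hμ'X
    have hBZ : B ⊆ Z := by
      intro x hx
      rw [hB, Finset.mem_union, Finset.mem_filter] at hx
      rw [hZ, Finset.mem_union]
      tauto
    have hcard := held_lad hCh hlad hBZ hZX
    rw [hHB] at hcard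
    have hZW : ∀ x ∈ held Ch Z, x.2.1 ∈ W → x ∈ held Ch (proposals X u (Drej X Ch u t)) := by
      intro x hx hxW
      rw [hheld]
      refine held_subst hsub Finset.subset_union_left hZX ?_ hx
      have := held_sub hx
      rw [hZ, Finset.mem_union] at this
      exact this.elim id (fun h => hWA x h hxW)
    have hZN : ∀ x ∈ held Ch Z, x.2.1 ∉ W → x ∈ μ' := by
      intro x hx hxW
      rw [← hHB]
      refine held_subst hsub hBZ hZX ?_ hx
      have := held_sub hx
      rw [hZ, Finset.mem_union] at this
      rw [hB, Finset.mem_union, Finset.mem_filter]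
      tauto
    have c1 := Finset.card_filter_add_card_filter_not (s := held Ch Z) (fun x => x.2.1 ∈ W)
    have c2 := Finset.card_filter_add_card_filter_not (s := μ') (fun x => x.2.1 ∈ W)
    have c3 : ((held Ch Z).filter fun x => ¬ x.2.1 ∈ W).card ≤
        (μ'.filter fun x => ¬ x.2.1 ∈ W).card := by
      apply Finset.card_le_card
      intro x hx
      rw [Finset.mem_filter] at hx ⊢
      exact ⟨hZN x hx.1 hx.2, hx.2⟩
    have c4 : W.card ≤ (μ'.filter fun x => x.2.1 ∈ W).card := by
      refine (Finset.card_le_card ?_).trans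
        (Finset.card_image_le (f := fun x : C × S × T => x.2.1))
      intro s hs
      obtain ⟨x, hx, rfl⟩ := hmatch s hs
      exact Finset.mem_image.2 ⟨x, Finset.mem_filter.2 ⟨hx, hs⟩, rfl⟩
    have c5 : ((held Ch Z).filter fun x => x.2.1 ∈ W).card ≤ (W.erase x₀.2.1).card := by
      apply Finset.card_le_card_of_injOn (fun x => x.2.1)
      · intro x hx
        rw [Finset.mem_coe, Finset.mem_filter] at hx
        rw [Finset.mem_coe, Finset.mem_erase]
        refine ⟨fun h => ?_, hx.2⟩
        have h1 := hZW x hx.1 hx.2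
        have := hPall x (held_sub h1) x₀ hx₀P.1 h
        exact hx₀P.2 (this ▸ h1)
      · intro x hx y hy hxy
        rw [Finset.mem_coe, Finset.mem_filter] at hx hy
        exact hPall x (held_sub (hZW x hx.1 hx.2)) y (held_sub (hZW y hy.1 hy.2)) hxy
    have c6 := Finset.card_erase_lt_of_mem hx₀W
    omega

end Helpers

/-- under substitutes + LAD the deferred acceptance mechanism is
group-strategy-proof. -/
theorem statement_2 [Fintype C] [Fintype S] [Fintype T]
    (X : Finset (C × S × T)) (Ch : C → Finset (C × S × T) → Finset (C × S × T))
    (hCh : ∀ c, IsChoice X c (Ch c))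
    (hsub : ∀ c, Substitutes X c (Ch c))
    (hlad : ∀ c, LAD X c (Ch c)) :
    GSP X (DA X Ch) := by
  exact main_aux hCh hsub hlad

end MWC
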